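/- The function x ↦ (3i·x + 1)/((x − i)⁴·(x + i)³), viewed as a map from ℝ to ℂ, is integrable on ℝ, and its integral over ℝ equals πi/2. (This is the normal-direction integral arising from the trace expression tr[B₄ × ∂_{ξ_n}σ_{−3}] in equation (5.38), used in the evaluation (5.40) of case (b) for the twisted signature operator.) -/

import Mathlib

open Complex MeasureTheory

open Filter Topology

theorem ofReal_sub_I_ne_zero (x : ℝ) : (x : ℂ) - I ≠ 0 := fun h => by
  simpa using congrArg Complex.im h

theorem ofReal_add_I_ne_zero (x : ℝ) : (x : ℂ) + I ≠ 0 := fun h => by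
  simpa using congrArg Complex.im h

theorem norm_ofReal_sub_I_sq (x : ℝ) : ‖(x : ℂ) - I‖ ^ 2 = 1 + x ^ 2 := by
  rw [← normSq_eq_norm_sq, normSq_apply]
  simp
  ring

theorem norm_ofReal_add_I_sq (x : ℝ) : ‖(x : ℂ) + I‖ ^ 2 = 1 + x ^ 2 := by
  rw [← normSq_eq_norm_sq, normSq_apply]
  simp
  ring

theorem norm_integrand_le (x : ℝ) :
    ‖(3 * I * (x : ℂ) + 1) / (((x : ℂ) - I) ^ 4 * ((x : ℂ) + I) ^ 3)‖
      ≤ 4 * (1 + x ^ 2)⁻¹ := by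
  have hadd : ‖(x : ℂ) + I‖ = ‖(x : ℂ) - I‖ :=
    (sq_eq_sq₀ (norm_nonneg _) (norm_nonneg _)).1
      (by rw [norm_ofReal_add_I_sq, norm_ofReal_sub_I_sq])
  rw [norm_div, norm_mul, norm_pow, norm_pow, hadd, ← norm_ofReal_sub_I_sq]
  have hsq := norm_ofReal_sub_I_sq x
  set s := ‖(x : ℂ) - I‖
  have hs : 0 ≤ s := norm_nonneg _
  have hs1 : 1 ≤ s := by nlinarith [sq_nonneg x]
  have hx : |x| ≤ s := abs_le_of_sq_le_sq (by linarith) hs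
  have hnum : ‖3 * I * (x : ℂ) + 1‖ ≤ 4 * s := by
    calc ‖3 * I * (x : ℂ) + 1‖ ≤ ‖3 * I * (x : ℂ)‖ + ‖(1 : ℂ)‖ := norm_add_le _ _
      _ = 3 * |x| + 1 := by simp
      _ ≤ 4 * s := by linarith
  have hpow : s ^ 3 ≤ s ^ 7 := pow_le_pow_right₀ hs1 (by norm_num)
  rw [← div_eq_mul_inv, div_le_div_iff₀ (by positivity) (by positivity)]
  calc ‖3 * I * (x : ℂ) + 1‖ * s ^ 2 ≤ 4 * s * s ^ 2 := by gcongr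
    _ = 4 * s ^ 3 := by ring
    _ ≤ 4 * s ^ 7 := by gcongr
    _ = 4 * (s ^ 4 * s ^ 3) := by ring

theorem integrable_integrand :
    Integrable
      (fun x : ℝ => (3 * I * (x : ℂ) + 1) / (((x : ℂ) - I) ^ 4 * ((x : ℂ) + I) ^ 3)) := by
  refine (integrable_inv_one_add_sq.const_mul 4).mono' ?_ (ae_of_all _ norm_integrand_le)
  refine (Continuous.div (by fun_prop) (by fun_prop) fun x => ?_).aestronglyMeasurable
  exact mul_ne_zero (pow_ne_zero _ (ofReal_sub_I_ne_zero x)) (pow_ne_zero _ (ofReal_add_I_ne_zero x))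

/-- The rational part of an antiderivative of the integrand, from partial fractions. -/
noncomputable def rationalPart (x : ℝ) : ℂ :=
  I / 12 * ((x : ℂ) - I)⁻¹ ^ 3 + 3 * I / 16 * ((x : ℂ) - I)⁻¹
    - 1 / 8 * ((x : ℂ) + I)⁻¹ ^ 2 + 5 * I / 16 * ((x : ℂ) + I)⁻¹

theorem hasDerivAt_antiderivative (x : ℝ) :
    HasDerivAt (fun x : ℝ => rationalPart x + I / 2 * (Real.arctan x : ℂ))
      ((3 * I * (x : ℂ) + 1) / (((x : ℂ) - I) ^ 4 * ((x : ℂ) + I) ^ 3)) x := by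
  have hu := ofReal_sub_I_ne_zero x
  have hv := ofReal_add_I_ne_zero x
  have du := ((hasDerivAt_id x).ofReal_comp.sub_const I).fun_inv hu
  have dv := ((hasDerivAt_id x).ofReal_comp.add_const I).fun_inv hv
  have da := (Real.hasDerivAt_arctan x).ofReal_comp
  have hF := (((((du.fun_pow 3).const_mul (I / 12)).add (du.const_mul (3 * I / 16))).sub
    ((dv.fun_pow 2).const_mul (1 / 8))).add (dv.const_mul (5 * I / 16))).add
    (da.const_mul (I / 2))
  refine hF.congr_deriv ?_
  have hw : (1 : ℂ) + (x : ℂ) ^ 2 = ((x : ℂ) - I) * ((x : ℂ) + I) := by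
    linear_combination I_sq
  simp only [id]
  push_cast
  rw [hw]
  field_simp
  have hI := I_sq
  grind

theorem tendsto_rationalPart {l : Filter ℝ} (hl : l ≤ Bornology.cobounded ℝ) :
    Tendsto rationalPart l (𝓝 0) := by
  have hcoe : Tendsto (fun x : ℝ => (x : ℂ)) l (Bornology.cobounded ℂ) :=
    (RCLike.tendsto_ofReal_cobounded_cobounded ℂ).mono_left hl
  have hu : Tendsto (fun x : ℝ => ((x : ℂ) - I)⁻¹) l (𝓝 0) :=
    tendsto_inv₀_cobounded.comp ((tendsto_sub_const_cobounded I).comp hcoe)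
  have hv : Tendsto (fun x : ℝ => ((x : ℂ) + I)⁻¹) l (𝓝 0) :=
    tendsto_inv₀_cobounded.comp ((tendsto_add_const_cobounded I).comp hcoe)
  have h := ((((hu.pow 3).const_mul (I / 12)).add (hu.const_mul (3 * I / 16))).sub
    ((hv.pow 2).const_mul (1 / 8))).add (hv.const_mul (5 * I / 16))
  have h0 : I / 12 * 0 ^ 3 + 3 * I / 16 * 0 - 1 / 8 * 0 ^ 2 + 5 * I / 16 * 0 = 0 := by ring
  rwa [h0] at h

theorem stmt_13 :
    MeasureTheory.Integrable
      (fun x : ℝ => (3 * I * (x : ℂ) + 1) / (((x : ℂ) - I) ^ 4 * ((x : ℂ) + I) ^ 3)) ∧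
    ∫ x : ℝ, (3 * I * (x : ℂ) + 1) / (((x : ℂ) - I) ^ 4 * ((x : ℂ) + I) ^ 3) = (Real.pi : ℂ) * I / 2 := by
  refine ⟨integrable_integrand, ?_⟩
  have hbot := (tendsto_rationalPart IsOrderBornology.atBot_le_cobounded).add
    (((continuous_ofReal.tendsto _).comp
      (tendsto_nhds_of_tendsto_nhdsWithin Real.tendsto_arctan_atBot)).const_mul (I / 2))
  have htop := (tendsto_rationalPart IsOrderBornology.atTop_le_cobounded).add
    (((continuous_ofReal.tendsto _).comp
      (tendsto_nhds_of_tendsto_nhdsWithin Real.tendsto_arctan_atTop)).const_mul (I / 2))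
  rw [integral_of_hasDerivAt_of_tendsto hasDerivAt_antiderivative integrable_integrand hbot htop]
  push_cast
  ring
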